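/- arXiv:1510.02290 — 2 statements merged into one kernel-verified Lean document; each statement's English description precedes it below -/
import Mathlib

section
/- Let C ∈ ℂ^{n×n} and let μ := min{Re(λ) : λ is an eigenvalue of C}. Suppose that every eigenvalue λ of C with Re(λ) = μ is non-defective, i.e. its geometric multiplicity (the dimension of ker(C − λ I)) equals its algebraic multiplicity (its multiplicity as a root of the characteristic polynomial). Then there exists a Hermitian positive definite matrix P ∈ ℂ^{n×n} such that C* P + P C − 2μ P is positive semidefinite, where C* denotes the conjugate transpose of C. -/
open Matrix
open scoped ComplexOrder

lemma lyap_key {n : ℕ} (C : Matrix (Fin n) (Fin n) ℂ) (μ ε : ℝ) (lam : ℂ) (hε : 0 < ε)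
    (hl : lam.re = μ + ε) (m : ℕ) : ∀ B : Matrix (Fin n) (Fin n) ℂ, Commute C B →
    (C - lam • (1 : Matrix (Fin n) (Fin n) ℂ)) ^ m * B = 0 →
    ∃ P : Matrix (Fin n) (Fin n) ℂ, (P - Bᴴ * B).PosSemidef ∧
      (Cᴴ * P + P * C - (2 * (μ : ℂ)) • P - (ε : ℂ) • (Bᴴ * B)).PosSemidef := by
  have hεC : (ε : ℂ) ≠ 0 := by exact_mod_cast hε.ne'
  have hsum : star lam = 2 * μ + 2 * ε - lam := by
    apply Complex.ext
    · simp [hl]; ring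
    · simp
  have he : (0 : ℂ) ≤ (ε : ℂ) := by exact_mod_cast hε.le
  have hs : (0 : ℂ) ≤ (((ε⁻¹) ^ 2 : ℝ) : ℂ) := by
    have : (0 : ℝ) ≤ (ε⁻¹) ^ 2 := by positivity
    exact_mod_cast this
  induction m with
  | zero =>
    intro B _ h0
    have hB : B = 0 := by simpa using h0
    subst hB
    exact ⟨0, by simpa using PosSemidef.zero, by simpa using PosSemidef.zero⟩
  | succ m ih =>
    intro B hcomm h0
    obtain ⟨B', hB'⟩ : ∃ B', B' = (C - lam • (1 : Matrix (Fin n) (Fin n) ℂ)) * B := ⟨_, rfl⟩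
    have hc1 : Commute C (C - lam • (1 : Matrix (Fin n) (Fin n) ℂ)) :=
      (Commute.refl C).sub_right ((Commute.one_right C).smul_right lam)
    obtain ⟨P', h1, h2⟩ := ih B' (hB' ▸ hc1.mul_right hcomm)
      (by rw [hB', ← mul_assoc, ← pow_succ]; exact h0)
    have hBC : B * C = B' + lam • B := by
      rw [← hcomm.eq, hB', sub_mul, smul_mul_assoc, one_mul]; abel
    have hCB : Cᴴ * Bᴴ = B'ᴴ + star lam • Bᴴ := by
      rw [← conjTranspose_mul, hBC, conjTranspose_add, conjTranspose_smul]
    have hP' : P'.PosSemidef := by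
      have := h1.add (posSemidef_conjTranspose_mul_self B')
      simpa using this
    refine ⟨Bᴴ * B + (((ε⁻¹) ^ 2 : ℝ) : ℂ) • P', ?_, ?_⟩
    · rw [add_sub_cancel_left]
      exact hP'.smul hs
    · have h3 := ((posSemidef_conjTranspose_mul_self (B + ((ε : ℂ)⁻¹) • B')).smul he).add
        (h2.smul hs)
      convert h3 using 1
      have hst : star ((ε : ℂ)⁻¹) = (ε : ℂ)⁻¹ := by simp
      simp only [mul_add, add_mul, conjTranspose_add, conjTranspose_smul, hst, mul_assoc, hBC,
        smul_mul_assoc, mul_smul_comm, smul_add, smul_sub, smul_smul]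
      rw [← mul_assoc Cᴴ Bᴴ B, hCB, hsum]
      simp only [add_mul, smul_mul_assoc, mul_add, mul_smul_comm]
      push_cast
      have e1 : (ε : ℂ) * (ε : ℂ)⁻¹ = 1 := mul_inv_cancel₀ hεC
      match_scalars <;> field_simp <;> ring

lemma lyap_zero {n : ℕ} (C : Matrix (Fin n) (Fin n) ℂ) (μ : ℝ) (lam : ℂ)
    (hl : lam.re = μ) (B : Matrix (Fin n) (Fin n) ℂ) (hcomm : Commute C B)
    (h0 : (C - lam • (1 : Matrix (Fin n) (Fin n) ℂ)) * B = 0) :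
    (Cᴴ * (Bᴴ * B) + (Bᴴ * B) * C - (2 * (μ : ℂ)) • (Bᴴ * B)).PosSemidef := by
  have hsum : star lam = 2 * μ - lam := by
    apply Complex.ext
    · simp [hl]; ring
    · simp
  have hBC : B * C = lam • B := by
    rw [← hcomm.eq]
    rw [sub_mul, smul_mul_assoc, one_mul, sub_eq_zero] at h0
    exact h0
  have hCB : Cᴴ * Bᴴ = star lam • Bᴴ := by
    rw [← conjTranspose_mul, hBC, conjTranspose_smul]
  convert PosSemidef.zero using 1
  rw [← mul_assoc, hCB, mul_assoc, hBC, hsum, smul_mul_assoc, mul_smul_comm]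
  module

lemma nondef_ker {n : ℕ} (C : Matrix (Fin n) (Fin n) ℂ) (lam : ℂ)
    (h : Module.finrank ℂ
      (LinearMap.ker (Matrix.toLin' (C - lam • (1 : Matrix (Fin n) (Fin n) ℂ))))
        = Polynomial.rootMultiplicity lam C.charpoly)
    (m : ℕ) (B : Matrix (Fin n) (Fin n) ℂ)
    (h0 : (C - lam • (1 : Matrix (Fin n) (Fin n) ℂ)) ^ m * B = 0) :
    (C - lam • (1 : Matrix (Fin n) (Fin n) ℂ)) * B = 0 := by
  have hN : Matrix.toLin' (C - lam • (1 : Matrix (Fin n) (Fin n) ℂ)) =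
      Matrix.toLin' C - lam • (1 : Module.End ℂ (Fin n → ℂ)) := by
    rw [map_sub, map_smul, Matrix.toLin'_one]; rfl
  have hle : LinearMap.ker (Matrix.toLin' (C - lam • (1 : Matrix (Fin n) (Fin n) ℂ))) ≤
      Module.End.maxGenEigenspace (Matrix.toLin' C) lam := by
    intro x hx
    rw [Module.End.mem_maxGenEigenspace]
    refine ⟨1, ?_⟩
    rw [pow_one, ← hN]
    exact hx
  have heq := Submodule.eq_of_le_of_finrank_eq hle (by
    rw [h, LinearMap.finrank_maxGenEigenspace_eq, Matrix.charpoly_toLin'])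
  apply Matrix.toLin'.injective
  rw [map_zero, Matrix.toLin'_mul]
  ext1 i
  apply LinearMap.ext
  intro c
  simp only [LinearMap.comp_apply]
  rw [LinearMap.zero_apply, ← LinearMap.mem_ker, heq, Module.End.mem_maxGenEigenspace]
  refine ⟨m, ?_⟩
  rw [← hN, ← Matrix.toLin'_pow, ← LinearMap.comp_apply, ← Matrix.toLin'_mul, h0]
  simp

lemma sum_posDef {n : ℕ} (t : Finset ℂ) (B : ℂ → Matrix (Fin n) (Fin n) ℂ)
    (U : ℂ → Matrix (Fin n) (Fin n) ℂ) (h : ∑ a ∈ t, U a * B a = 1) :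
    (∑ a ∈ t, (B a)ᴴ * B a).PosDef := by
  refine PosDef.of_dotProduct_mulVec_pos
    (posSemidef_sum t fun a _ => posSemidef_conjTranspose_mul_self (B a)).1 fun x hx => ?_
  have hterm : ∀ a, star x ⬝ᵥ ((B a)ᴴ * B a) *ᵥ x = star (B a *ᵥ x) ⬝ᵥ (B a *ᵥ x) := by
    intro a
    rw [← mulVec_mulVec, dotProduct_mulVec, star_mulVec]
  rw [Matrix.sum_mulVec, dotProduct_sum]
  simp only [hterm]
  refine Finset.sum_pos' (fun a _ => dotProduct_star_self_nonneg _) ?_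
  by_contra! hcon
  apply hx
  have hz : ∀ a ∈ t, B a *ᵥ x = 0 := by
    intro a ha
    by_contra hne
    exact hcon a ha (dotProduct_star_self_pos_iff.mpr hne)
  calc x = (1 : Matrix (Fin n) (Fin n) ℂ) *ᵥ x := (one_mulVec x).symm
    _ = ∑ a ∈ t, U a *ᵥ (B a *ᵥ x) := by
      rw [← h, Matrix.sum_mulVec]; simp only [mulVec_mulVec]
    _ = 0 := Finset.sum_eq_zero fun a ha => by rw [hz a ha, mulVec_zero]

lemma exists_proj {n : ℕ} (C : Matrix (Fin n) (Fin n) ℂ) (hne : (spectrum ℂ C).Nonempty) :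
    ∃ (t : Finset ℂ) (B U : ℂ → Matrix (Fin n) (Fin n) ℂ), (∀ a ∈ t, a ∈ spectrum ℂ C) ∧
      ∑ a ∈ t, U a * B a = 1 ∧ ∀ a ∈ t, Commute C (B a) ∧
        ∃ m : ℕ, (C - a • (1 : Matrix (Fin n) (Fin n) ℂ)) ^ m * B a = 0 := by
  classical
  set p := C.charpoly with hp
  have hp0 : p ≠ 0 := C.charpoly_monic.ne_zero
  let s : ℂ → Polynomial ℂ := fun a => (Polynomial.X - Polynomial.C a) ^ (p.roots.count a)
  have hprod : ∏ a ∈ p.roots.toFinset, s a = p := by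
    exact ((IsAlgClosed.splits p).eq_prod_roots_of_monic C.charpoly_monic |>.trans
      (Finset.prod_multiset_map_count _ _)).symm
  have hmem : ∀ a, a ∈ p.roots.toFinset ↔ a ∈ spectrum ℂ C := by
    intro a
    rw [Multiset.mem_toFinset, Polynomial.mem_roots hp0, Matrix.mem_spectrum_iff_isRoot_charpoly]
  have htne : p.roots.toFinset.Nonempty := by
    obtain ⟨a, ha⟩ := hne
    exact ⟨a, (hmem a).2 ha⟩
  obtain ⟨u, hu⟩ := (exists_sum_eq_one_iff_pairwise_coprime (s := s) htne).2 (by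
    intro i j hij
    exact (Polynomial.pairwise_coprime_X_sub_C Subtype.val_injective hij).pow)
  refine ⟨p.roots.toFinset,
    fun a => Polynomial.aeval C (∏ j ∈ p.roots.toFinset \ {a}, s j),
    fun a => Polynomial.aeval C (u a), fun a ha => (hmem a).1 ha, ?_, ?_⟩
  · simp only [← map_mul, ← map_sum]
    rw [hu, map_one]
  · intro a ha
    refine ⟨?_, p.roots.count a, ?_⟩
    · have := Polynomial.aeval_X (R := ℂ) C
      conv => arg 1; rw [← this]
      exact (Commute.all _ _).map (Polynomial.aeval C)
    · have h1 : (C - a • (1 : Matrix (Fin n) (Fin n) ℂ)) ^ (p.roots.count a)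
          = Polynomial.aeval C (s a) := by
        simp [s, Algebra.algebraMap_eq_smul_one]
      rw [h1, ← map_mul, ← Finset.prod_eq_mul_prod_sdiff_singleton_of_mem ha, hprod, hp,
        Matrix.aeval_self_charpoly]

/-- Lemma on Lyapunov matrices: let `C ∈ ℂⁿˣⁿ` and let
`μ = min {Re λ : λ eigenvalue of C}`.  If every eigenvalue `λ` with `Re λ = μ` is
non-defective (geometric multiplicity = algebraic multiplicity), then there is a
Hermitian positive definite `P` with `C* P + P C ⪰ 2μ P`. -/
theorem stmt_10
    (n : ℕ) (C : Matrix (Fin n) (Fin n) ℂ) (μ : ℝ)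
    (hμ_mem : ∃ lam ∈ spectrum ℂ C, lam.re = μ)
    (hμ_min : ∀ lam ∈ spectrum ℂ C, μ ≤ lam.re)
    (hnondef : ∀ lam ∈ spectrum ℂ C, lam.re = μ →
      Module.finrank ℂ (LinearMap.ker (Matrix.toLin' (C - lam • (1 : Matrix (Fin n) (Fin n) ℂ))))
        = Polynomial.rootMultiplicity lam C.charpoly) :
    ∃ P : Matrix (Fin n) (Fin n) ℂ, P.PosDef ∧
      (Cᴴ * P + P * C - (2 * (μ : ℂ)) • P).PosSemidef := by
  obtain ⟨t, B, U, hspec, hone, hB⟩ := exists_proj C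
    (by obtain ⟨l, hl, _⟩ := hμ_mem; exact ⟨l, hl⟩)
  have hex : ∀ a, ∃ P : Matrix (Fin n) (Fin n) ℂ, a ∈ t → (P - (B a)ᴴ * B a).PosSemidef ∧
      (Cᴴ * P + P * C - (2 * (μ : ℂ)) • P).PosSemidef := by
    intro a
    by_cases ha : a ∈ t
    swap
    · exact ⟨0, fun h => absurd h ha⟩
    obtain ⟨hc, m, hm⟩ := hB a ha
    rcases (hμ_min a (hspec a ha)).eq_or_lt with heq | hlt
    · refine ⟨(B a)ᴴ * B a, fun _ => ⟨by simpa using PosSemidef.zero, ?_⟩⟩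
      exact lyap_zero C μ a heq.symm (B a) hc
        (nondef_ker C a (hnondef a (hspec a ha) heq.symm) m (B a) hm)
    · have hε : 0 < a.re - μ := sub_pos.2 hlt
      obtain ⟨P, h1, h2⟩ := lyap_key C μ (a.re - μ) a hε (by ring) m (B a) hc hm
      have he : (0 : ℂ) ≤ ((a.re - μ : ℝ) : ℂ) := by exact_mod_cast hε.le
      refine ⟨P, fun _ => ⟨h1, ?_⟩⟩
      have h3 := h2.add ((posSemidef_conjTranspose_mul_self (B a)).smul he)
      rwa [sub_add_cancel] at h3
  choose P hP using hex
  refine ⟨∑ a ∈ t, P a, ?_, ?_⟩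
  · have h := (sum_posDef t B U hone).add_posSemidef
      (posSemidef_sum t fun a ha => (hP a ha).1)
    rwa [← Finset.sum_add_distrib, Finset.sum_congr rfl
      (fun a _ => add_sub_cancel ((B a)ᴴ * B a) (P a))] at h
  · have h := posSemidef_sum t fun a ha => (hP a ha).2
    rwa [Finset.sum_sub_distrib, Finset.sum_add_distrib, ← Finset.mul_sum, ← Finset.sum_mul,
      ← Finset.smul_sum] at h
end

section
/- Let σ > 0 with 1/(2σ) ∉ ℕ, and let f = (f_+, f_−) be a classical solution, 2π-periodic in x, of the two-velocity BGK system ∂_t f_± ± σ ∂_x f_± = ±(1/2)(f_− − f_+) on t ≥ 0, x ∈ ℝ, with initial datum f^I = (f_+^I, f_−^I) ∈ L²(0, 2π; ℝ²). Set f_+^∞ = f_−^∞ := (1/(4π)) ∫_0^{2π} (f_+^I(x) + f_−^I(x)) dx, and let λ := 1/2 − √(1/4 − σ²) if σ < 1/2 and λ := 1/2 if σ > 1/2 (i.e. λ = Re(1/2 − √(1/4 − σ²))). Then there exists a constant c > 0 (depending only on σ) such that ‖f(·, t) − f^∞‖_{L²(0,2π;ℝ²)} ≤ c · e^{−λ t}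 · ‖f^I − f^∞‖_{L²(0,2π;ℝ²)} for all t ≥ 0. -/
open Real Set MeasureTheory

lemma deriv_nonneg_of_left_max {f : ℝ → ℝ} {f' t a : ℝ} (hf : HasDerivAt f f' t) (ha : a < t)
    (hm : ∀ s, a < s → s < t → f s ≤ f t) : 0 ≤ f' := by
  have h1 := (hasDerivAt_iff_tendsto_slope.1 hf)
  have h2 : Filter.Tendsto (slope f t) (nhdsWithin t (Iio t)) (nhds f') :=
    h1.mono_left (nhdsWithin_mono _ (fun x hx => ne_of_lt hx))
  refine ge_of_tendsto h2 ?_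
  filter_upwards [Ioo_mem_nhdsLT ha] with s hs
  rw [slope_def_field]
  have := hm s hs.1 hs.2
  exact div_nonneg_of_nonpos (by linarith) (by linarith [hs.2])

lemma mild_le (c : ℝ) (u h g : ℝ → ℝ → ℝ)
    (hu : Continuous (fun q : ℝ × ℝ => u q.1 q.2))
    (hh : Continuous (fun q : ℝ × ℝ => h q.1 q.2))
    (hx : ∀ x t : ℝ, 0 ≤ t → HasDerivAt (fun y => u y t) (g x t) x)
    (ht : ∀ x t : ℝ, 0 ≤ t → HasDerivAt (fun s => u x s) (-c * g x t + h x t) t)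
    (x0 T : ℝ) (hT : 0 ≤ T) :
    u (x0 + c * T) T ≤ u x0 0 + ∫ s in (0:ℝ)..T, h (x0 + c * s) s := by
  set m : ℝ → ℝ := fun s => h (x0 + c * s) s with hmdef
  have hm : Continuous m := hh.comp (f := fun s : ℝ => (x0 + c * s, s)) (by fun_prop)
  set M : ℝ → ℝ := fun t => ∫ s in (0:ℝ)..t, m s with hMdef
  have hMd : ∀ t, HasDerivAt M (m t) t := fun t =>
    intervalIntegral.integral_hasDerivAt_right (hm.intervalIntegrable _ _)
      (hm.stronglyMeasurableAtFilter _ _) hm.continuousAt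
  have hMc : Continuous M := continuous_iff_continuousAt.2 fun t => (hMd t).continuousAt
  have hM0 : M 0 = 0 := by simp [hMdef]
  suffices H : ∀ ε > 0, u (x0 + c * T) T ≤ u x0 0 + M T + ε * (T + 1) by
    refine le_of_forall_pos_le_add fun ε hε => ?_
    have := H (ε / (T + 1)) (by positivity)
    rwa [div_mul_cancel₀ _ (by positivity)] at this
  intro ε hε
  have hH : Continuous (fun q : ℝ × ℝ => h (q.1 + c * q.2) q.2) :=
    hh.comp (f := fun q : ℝ × ℝ => (q.1 + c * q.2, q.2)) (by fun_prop)
  have hU : Continuous (fun q : ℝ × ℝ => u (q.1 + c * q.2) q.2) :=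
    hu.comp (f := fun q : ℝ × ℝ => (q.1 + c * q.2, q.2)) (by fun_prop)
  -- uniform continuity
  have hK : IsCompact (Icc (x0 - 1) (x0 + 1) ×ˢ Icc (0:ℝ) T) := isCompact_Icc.prod isCompact_Icc
  obtain ⟨δ1, hδ1, hd1⟩ := Metric.uniformContinuousOn_iff.1
    (hK.uniformContinuousOn_of_continuous hH.continuousOn) ε hε
  obtain ⟨δ2, hδ2, hd2⟩ := Metric.uniformContinuousOn_iff.1
    (hK.uniformContinuousOn_of_continuous hU.continuousOn) ε hε
  obtain ⟨δ, hδ, hδle1, hδle2, hδle3⟩ : ∃ δ > 0, δ < δ1 ∧ δ < δ2 ∧ δ ≤ 1 := by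
    refine ⟨min (min (δ1/2) (δ2/2)) 1, by positivity, ?_, ?_, min_le_right _ _⟩
    · exact lt_of_le_of_lt ((min_le_left _ _).trans (min_le_left _ _)) (by linarith)
    · exact lt_of_le_of_lt ((min_le_left _ _).trans (min_le_right _ _)) (by linarith)
  have hb : Continuous (fun q : ℝ × ℝ => u (q.1 + c * q.2) q.2 - M q.2 - ε * q.2) := by fun_prop
  have hK2 : IsCompact (Icc (x0 - δ) (x0 + δ) ×ˢ Icc (0:ℝ) T) := isCompact_Icc.prod isCompact_Icc
  obtain ⟨B, hB⟩ := hK2.exists_bound_of_continuousOn hb.continuousOn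
  set A := (2 * B + 1) / δ ^ 2 with hA
  have hAd : A * δ ^ 2 = 2 * B + 1 := by rw [hA]; field_simp
  have hB0 : 0 ≤ B := (norm_nonneg _).trans
    (hB (x0, 0) ⟨⟨by simp; linarith, by simp; linarith⟩, ⟨le_rfl, hT⟩⟩)
  have hA0 : 0 ≤ A := by positivity
  have hc : Continuous (fun q : ℝ × ℝ => u (q.1 + c * q.2) q.2 - M q.2 - ε * q.2
    - A * (q.1 - x0) ^ 2) := by fun_prop
  obtain ⟨⟨ξ, t⟩, ⟨hξ, htt⟩, hmax⟩ := hK2.exists_isMaxOn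
    ⟨(x0, 0), ⟨⟨by simp; linarith, by simp; linarith⟩, ⟨le_rfl, hT⟩⟩⟩ hc.continuousOn
  simp only at hξ htt
  have hmax' : ∀ y s, x0 - δ ≤ y → y ≤ x0 + δ → 0 ≤ s → s ≤ T →
      u (y + c * s) s - M s - ε * s - A * (y - x0) ^ 2 ≤
      u (ξ + c * t) t - M t - ε * t - A * (ξ - x0) ^ 2 := fun y s h1 h2 h3 h4 =>
    hmax (show (y, s) ∈ _ from ⟨⟨h1, h2⟩, ⟨h3, h4⟩⟩)
  have hbd : ∀ y s, x0 - δ ≤ y → y ≤ x0 + δ → 0 ≤ s → s ≤ T →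
      |u (y + c * s) s - M s - ε * s| ≤ B := fun y s h1 h2 h3 h4 =>
    hB (y, s) ⟨⟨h1, h2⟩, ⟨h3, h4⟩⟩
  -- not on lateral boundary
  have hint : |ξ - x0| < δ := by
    by_contra hcon
    push Not at hcon
    have h1 : δ ^ 2 ≤ (ξ - x0) ^ 2 := by
      rw [← sq_abs (ξ - x0)]; gcongr
    have h2 := hmax' x0 0 (by linarith) (by linarith) le_rfl hT
    have h3 := (abs_le.1 (hbd x0 0 (by linarith) (by linarith) le_rfl hT)).1
    have h4 := (abs_le.1 (hbd ξ t hξ.1 hξ.2 htt.1 htt.2)).2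
    have h5 := mul_le_mul_of_nonneg_left h1 hA0
    have h6 : A * (x0 - x0) ^ 2 = 0 := by simp
    linarith
  obtain ⟨hi1, hi2⟩ := abs_lt.1 hint
  -- t = 0
  have ht0 : t = 0 := by
    by_contra hne
    have htpos : 0 < t := lt_of_le_of_ne htt.1 (Ne.symm hne)
    set X := ξ + c * t with hX
    -- x derivative
    have hdx : HasDerivAt (fun y => u y t - M t - ε * t - A * (y - c * t - x0) ^ 2)
        (g X t - A * (2 * (ξ - x0))) X := by
      have e : HasDerivAt (fun y : ℝ => A * (y - c * t - x0) ^ 2) (A * (2 * (ξ - x0))) X := by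
        have := ((((hasDerivAt_id X).sub_const (c * t)).sub_const x0).pow 2).const_mul A
        refine this.congr_deriv ?_
        simp [hX]
      exact (((hx X t htt.1).sub_const _).sub_const _).sub e
    have hloc : IsLocalMax (fun y => u y t - M t - ε * t - A * (y - c * t - x0) ^ 2) X := by
      have : Ioo (x0 - δ + c * t) (x0 + δ + c * t) ∈ nhds X :=
        Ioo_mem_nhds (by rw [hX]; linarith) (by rw [hX]; linarith)
      filter_upwards [this] with y hy
      have := hmax' (y - c * t) t (by linarith [hy.1]) (by linarith [hy.2]) htt.1 htt.2
      rw [hX] at *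
      simpa using this
    have hgz := hloc.hasDerivAt_eq_zero hdx
    -- t derivative
    have hdt : HasDerivAt (fun s => u X s - M s - ε * s - A * (X - c * s - x0) ^ 2)
        (-c * g X t + h X t - m t - ε - A * (2 * (ξ - x0) * (-c))) t := by
      have e : HasDerivAt (fun s : ℝ => A * (X - c * s - x0) ^ 2) (A * (2 * (ξ - x0) * (-c))) t := by
        have := (((((hasDerivAt_id t).const_mul c).const_sub X).sub_const x0).pow 2).const_mul A
        refine this.congr_deriv ?_
        simp [hX]
      have e2 : HasDerivAt (fun s : ℝ => ε * s) ε t := by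
        simpa using (hasDerivAt_id t).const_mul ε
      exact (((ht X t htt.1).sub (hMd t)).sub e2).sub e
    have hev : ∀ᶠ s in nhds t, |X - c * s - x0| < δ := by
      have hcc : Continuous (fun s : ℝ => |X - c * s - x0|) := by fun_prop
      refine hcc.continuousAt.eventually_lt continuousAt_const ?_
      simpa [hX] using hint
    obtain ⟨η, hη, hev⟩ := Metric.eventually_nhds_iff.1 hev
    have hnn := deriv_nonneg_of_left_max hdt (a := max 0 (t - η)) (max_lt htpos (by linarith)) (by
      intro s h1 h2
      have h3 : 0 < s := (le_max_left _ _).trans_lt h1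
      have h4 : t - η < s := (le_max_right _ _).trans_lt h1
      have h5 := abs_lt.1 (hev (y := s) (by rw [Real.dist_eq, abs_lt]; constructor <;> linarith))
      have := hmax' (X - c * s) s (by linarith) (by linarith) h3.le (by linarith [htt.2])
      simp only [sub_add_cancel] at this
      simpa [hX] using this)
    have hclose := hd1 (ξ, t) ⟨⟨by simp; linarith, by simp; linarith⟩, htt⟩
      (x0, t) ⟨⟨by simp, by simp⟩, htt⟩ (by
        rw [Prod.dist_eq]; simp [Real.dist_eq]; linarith)
    simp only [Real.dist_eq] at hclose
    have h7 := (abs_lt.1 hclose).2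
    have h8 : h X t - m t < ε := h7
    have h9 : g X t = A * (2 * (ξ - x0)) := by linarith
    rw [h9] at hnn
    nlinarith
  have hfin := hmax' x0 T (by linarith) (by linarith) hT le_rfl
  have hcl := hd2 (ξ, 0) ⟨⟨by simp; linarith, by simp; linarith⟩, ⟨le_rfl, hT⟩⟩
      (x0, 0) ⟨⟨by simp, by simp⟩, ⟨le_rfl, hT⟩⟩ (by
        rw [Prod.dist_eq]; simp [Real.dist_eq]; linarith)
  simp only [Real.dist_eq, mul_zero, add_zero] at hcl
  have h10 := (abs_lt.1 hcl).2
  rw [ht0] at hfin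
  have h11 : 0 ≤ A * (ξ - x0) ^ 2 := by positivity
  simp only [mul_zero, add_zero, sub_self, hM0] at hfin
  have : A * 0 ^ 2 = 0 := by simp
  linarith

lemma mild_eq (c : ℝ) (u h g : ℝ → ℝ → ℝ)
    (hu : Continuous (fun q : ℝ × ℝ => u q.1 q.2))
    (hh : Continuous (fun q : ℝ × ℝ => h q.1 q.2))
    (hx : ∀ x t : ℝ, 0 ≤ t → HasDerivAt (fun y => u y t) (g x t) x)
    (ht : ∀ x t : ℝ, 0 ≤ t → HasDerivAt (fun s => u x s) (-c * g x t + h x t) t)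
    (x0 T : ℝ) (hT : 0 ≤ T) :
    u (x0 + c * T) T = u x0 0 + ∫ s in (0:ℝ)..T, h (x0 + c * s) s := by
  refine le_antisymm (mild_le c u h g hu hh hx ht x0 T hT) ?_
  have := mild_le c (fun x t => - u x t) (fun x t => - h x t) (fun x t => - g x t) hu.neg hh.neg
    (fun x t h0 => (hx x t h0).neg)
    (fun x t h0 => ((ht x t h0).neg).congr_deriv (by ring)) x0 T hT
  simp only [intervalIntegral.integral_neg] at this
  linarith

noncomputable def fc (k : ℤ) (f : ℝ → ℝ) : ℂ :=
  ∫ x in (0:ℝ)..(2 * π), Complex.exp (-(k * x) * Complex.I) * (f x : ℂ)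

lemma fc_shift (k : ℤ) (f : ℝ → ℝ) (hp : ∀ x, f (x + 2 * π) = f x) (d : ℝ) :
    fc k (fun x => f (x + d)) = Complex.exp (k * d * Complex.I) * fc k f := by
  unfold fc
  set G : ℝ → ℂ := fun x => Complex.exp (-(k * x) * Complex.I) * (f x : ℂ) with hG
  have hGp : Function.Periodic G (2 * π) := by
    intro x
    simp only [hG, hp]
    congr 1
    have : -((k:ℂ) * ((x + 2 * π : ℝ) : ℂ)) * Complex.I
        = -(k * x) * Complex.I + ((-k : ℤ) : ℂ) * (2 * π * Complex.I) := by
      push_cast; ring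
    rw [this, Complex.exp_add, Complex.exp_int_mul_two_pi_mul_I, mul_one]
  have h1 : ∀ x : ℝ, Complex.exp (-(k * x) * Complex.I) * (f (x + d) : ℂ)
      = Complex.exp (k * d * Complex.I) * G (x + d) := by
    intro x
    simp only [hG]
    rw [← mul_assoc, ← Complex.exp_add]
    congr 2
    push_cast; ring
  simp_rw [h1]
  rw [intervalIntegral.integral_const_mul, intervalIntegral.integral_comp_add_right G d]
  congr 1
  have := hGp.intervalIntegral_add_eq d 0
  rw [zero_add] at this
  rw [zero_add, add_comm (2 * π) d]
  exact this

lemma fc_cont (k : ℤ) (u : ℝ → ℝ → ℝ) (hu : Continuous (fun q : ℝ × ℝ => u q.1 q.2)) :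
    Continuous (fun t => fc k (fun x => u x t)) := by
  unfold fc
  refine intervalIntegral.continuous_parametric_intervalIntegral_of_continuous' ?_ _ _
  have : Continuous (fun p : ℝ × ℝ => u p.2 p.1) := hu.comp (continuous_swap)
  simp only [Function.uncurry_def]
  fun_prop

lemma fc_deriv (k : ℤ) (c : ℝ) (u h : ℝ → ℝ → ℝ)
    (hu : Continuous (fun q : ℝ × ℝ => u q.1 q.2))
    (hh : Continuous (fun q : ℝ × ℝ => h q.1 q.2))
    (hup : ∀ x t, u (x + 2 * π) t = u x t) (hhp : ∀ x t, h (x + 2 * π) t = h x t)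
    (hm : ∀ x t, 0 ≤ t → u (x + c * t) t = u x 0 + ∫ s in (0:ℝ)..t, h (x + c * s) s)
    (t : ℝ) (ht : 0 < t) :
    HasDerivAt (fun t => fc k (fun x => u x t))
      (-(k * c * Complex.I) * fc k (fun x => u x t) + fc k (fun x => h x t)) t := by
  set e : ℝ → ℂ := fun s => Complex.exp (k * (c * s : ℝ) * Complex.I) with he
  have hec : Continuous e := by fun_prop
  have hhc := fc_cont k h hh
  have key : ∀ t, 0 ≤ t → e t * fc k (fun x => u x t) =
      fc k (fun x => u x 0) + ∫ s in (0:ℝ)..t, e s * fc k (fun x => h x s) := by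
    intro t ht
    have h1 := fc_shift k (fun x => u x t) (fun x => hup x t) (c * t)
    have h2 : ∀ s, e s * fc k (fun x => h x s) = fc k (fun x => h (x + c * s) s) := fun s =>
      (fc_shift k (fun x => h x s) (fun x => hhp x s) (c * s)).symm
    simp_rw [h2]
    rw [he]
    simp only
    rw [← h1]
    simp_rw [hm _ t ht]
    have hH : Continuous (fun q : ℝ × ℝ => h (q.1 + c * q.2) q.2) :=
      hh.comp (f := fun q : ℝ × ℝ => (q.1 + c * q.2, q.2)) (by fun_prop)
    have hF : Continuous (fun q : ℝ × ℝ =>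
        Complex.exp (-(k * q.2) * Complex.I) * (h (q.2 + c * q.1) q.1 : ℂ)) := by
      have : Continuous (fun q : ℝ × ℝ => h (q.2 + c * q.1) q.1) := hH.comp continuous_swap
      fun_prop
    have hsw := intervalIntegral_intervalIntegral_swap (a := 0) (b := t) (c := 0) (d := 2 * π)
      (F := fun (s x : ℝ) => Complex.exp (-(k * x) * Complex.I) * (h (x + c * s) s : ℂ)) (by
        refine IntegrableOn.mono_set (t := uIcc 0 t ×ˢ uIcc 0 (2 * π)) ?_
          (prod_mono uIoc_subset_uIcc uIoc_subset_uIcc)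
        exact (hF.continuousOn).integrableOn_compact (isCompact_uIcc.prod isCompact_uIcc))
    unfold fc
    rw [hsw, ← intervalIntegral.integral_add]
    · refine intervalIntegral.integral_congr fun x _ => ?_
      simp only
      rw [intervalIntegral.integral_const_mul, intervalIntegral.integral_ofReal]
      push_cast; ring
    · apply Continuous.intervalIntegrable
      have : Continuous (fun x => u x 0) := hu.comp (f := fun x : ℝ => (x, (0:ℝ))) (by fun_prop)
      fun_prop
    · apply Continuous.intervalIntegrable
      refine intervalIntegral.continuous_parametric_intervalIntegral_of_continuous' ?_ _ _
      exact hF.comp continuous_swap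
  have hQ : Continuous (fun s => e s * fc k (fun x => h x s)) := hec.mul hhc
  have hd1 : HasDerivAt (fun t => fc k (fun x => u x 0) +
      ∫ s in (0:ℝ)..t, e s * fc k (fun x => h x s)) (e t * fc k (fun x => h x t)) t :=
    (intervalIntegral.integral_hasDerivAt_right (hQ.intervalIntegrable _ _)
      (hQ.stronglyMeasurableAtFilter _ _) hQ.continuousAt).const_add _
  set e' : ℝ → ℂ := fun s => Complex.exp (-(k * (c * s : ℝ) * Complex.I)) with he'
  have hee : ∀ s, e' s * e s = 1 := by
    intro s; simp only [he, he']; rw [← Complex.exp_add]; simp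
  have hde : HasDerivAt e' (e' t * (-(k * c * Complex.I))) t := by
    have h0 : HasDerivAt (fun s : ℝ => -((k:ℂ) * (c * s : ℝ) * Complex.I)) (-(k * c * Complex.I)) t := by
      have := (((((hasDerivAt_id t).const_mul c).ofReal_comp).const_mul (k:ℂ)).mul_const Complex.I).neg
      refine (this.congr_deriv ?_)
      simp
    exact h0.cexp
  have hd2 := hde.mul hd1
  have hloc : (fun t => fc k (fun x => u x t)) =ᶠ[nhds t] (e' * (fun t => fc k (fun x => u x 0) +
      ∫ s in (0:ℝ)..t, e s * fc k (fun x => h x s))) := by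
    filter_upwards [Ioi_mem_nhds ht] with s hs
    simp only [Pi.mul_apply]
    rw [← key s (le_of_lt hs), ← mul_assoc, hee, one_mul]
  refine (hd2.congr_of_eventuallyEq hloc).congr_deriv ?_
  rw [← key t ht.le]
  linear_combination (-(k * c * Complex.I) * fc k (fun x => u x t) + fc k (fun x => h x t)) * hee t

lemma fc_parseval (f : ℝ → ℝ) (hf : Continuous f) :
    HasSum (fun k => ‖fc k f‖ ^ 2) (2 * π * ∫ x in Set.Ioc (0:ℝ) (2 * π), f x ^ 2) := by
  have hpi : (0:ℝ) < 2 * π := by positivity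
  have hL : MemLp (fun x => (f x : ℂ)) 2 (volume.restrict (Ioc 0 (2 * π))) := by
    have hc : Continuous (fun x => (f x : ℂ)) := by fun_prop
    obtain ⟨C, hC⟩ := (isCompact_Icc (a := (0:ℝ)) (b := 2 * π)).exists_bound_of_continuousOn
      hc.continuousOn
    refine MemLp.of_bound hc.aestronglyMeasurable C ?_
    filter_upwards [ae_restrict_mem measurableSet_Ioc] with x hx
    exact hC x ⟨hx.1.le, hx.2⟩
  have h := (hasSum_sq_fourierCoeffOn hpi hL).mul_left ((2 * π) ^ 2)
  have e1 : (fun k => ‖fc k f‖ ^ 2) =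
      fun k => (2 * π) ^ 2 * ‖fourierCoeffOn hpi (fun x => (f x : ℂ)) k‖ ^ 2 := by
    funext k
    rw [fourierCoeffOn_eq_integral, norm_smul, mul_pow ‖_‖, ← mul_assoc]
    have : (2 * π) ^ 2 * ‖1 / (2 * π - 0)‖ ^ 2 = 1 := by
      rw [Real.norm_eq_abs, sq_abs]; field_simp; simp; ring
    rw [this, one_mul]
    congr 2
    unfold fc
    refine intervalIntegral.integral_congr fun x _ => ?_
    simp only [smul_eq_mul]
    rw [fourier_coe_apply]
    congr 2
    push_cast
    have : (π : ℂ) ≠ 0 := by exact_mod_cast pi_ne_zero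
    field_simp; simp; ring
  have e2 : 2 * π * ∫ x in Set.Ioc (0:ℝ) (2 * π), f x ^ 2 =
      (2 * π) ^ 2 * (2 * π - 0)⁻¹ • ∫ x in (0:ℝ)..2 * π, ‖(f x : ℂ)‖ ^ 2 := by
    rw [intervalIntegral.integral_of_le hpi.le]
    simp only [smul_eq_mul, Complex.norm_real, Real.norm_eq_abs, sq_abs, sub_zero]
    field_simp
  rw [e1, e2]
  exact h

lemma ode_gen (lam θ κ : ℝ) (p1 p2 q1 q2 : ℝ → ℝ)
    (c1 : Continuous p1) (c2 : Continuous p2) (c3 : Continuous q1) (c4 : Continuous q2)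
    (d1 : ∀ t, 0 < t → HasDerivAt p1 (κ * q2 t) t)
    (d2 : ∀ t, 0 < t → HasDerivAt p2 (-κ * q1 t) t)
    (d3 : ∀ t, 0 < t → HasDerivAt q1 (κ * p2 t - q1 t) t)
    (d4 : ∀ t, 0 < t → HasDerivAt q2 (-κ * p1 t - q2 t) t)
    (hneg : ∀ t a b c d : ℝ, 0 < t → a = p1 t → b = p2 t → -2 * (c^2+d^2) + θ * (κ * (c^2+d^2) - κ * (a^2+b^2) - (a*d - b*c))
      + 2 * lam * (a^2+b^2+c^2+d^2 + θ * (a*d-b*c)) ≤ 0)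
    (t : ℝ) (ht : 0 ≤ t) :
    p1 t^2+p2 t^2+q1 t^2+q2 t^2 + θ * (p1 t * q2 t - p2 t * q1 t) ≤
    Real.exp (-(2 * lam * t)) *
      (p1 0^2+p2 0^2+q1 0^2+q2 0^2 + θ * (p1 0 * q2 0 - p2 0 * q1 0)) := by
  set E : ℝ → ℝ := fun t => p1 t^2+p2 t^2+q1 t^2+q2 t^2 + θ * (p1 t * q2 t - p2 t * q1 t) with hE
  have hEd : ∀ t, 0 < t → HasDerivAt (fun t => Real.exp (2 * lam * t) * E t)
      (Real.exp (2 * lam * t) * (-2 * (q1 t^2+q2 t^2) + θ * (κ * (q1 t^2+q2 t^2)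
        - κ * (p1 t^2+p2 t^2) - (p1 t*q2 t - p2 t*q1 t))
      + 2 * lam * (p1 t^2+p2 t^2+q1 t^2+q2 t^2 + θ * (p1 t*q2 t-p2 t*q1 t)))) t := by
    intro t ht
    have e1 : HasDerivAt (fun t => Real.exp (2 * lam * t)) (Real.exp (2 * lam * t) * (2 * lam)) t := by
      have := ((hasDerivAt_id t).const_mul (2 * lam)).exp
      simpa using this
    have e2 := (((((d1 t ht).pow 2).add ((d2 t ht).pow 2)).add ((d3 t ht).pow 2)).add
      ((d4 t ht).pow 2)).add ((((d1 t ht).mul (d4 t ht)).sub ((d2 t ht).mul (d3 t ht))).const_mul θ)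
    refine (e1.mul e2).congr_deriv ?_
    simp
    ring
  have hanti : AntitoneOn (fun t => Real.exp (2 * lam * t) * E t) (Ici 0) := by
    refine antitoneOn_of_deriv_nonpos (convex_Ici 0) ?_ ?_ ?_
    · exact Continuous.continuousOn (by fun_prop)
    · intro t ht
      rw [interior_Ici] at ht
      exact (hEd t ht).differentiableAt.differentiableWithinAt
    · intro t ht
      rw [interior_Ici] at ht
      rw [(hEd t ht).deriv]
      exact mul_nonpos_of_nonneg_of_nonpos (Real.exp_pos _).le (hneg t _ _ _ _ ht rfl rfl)
  have h := hanti (show (0:ℝ) ∈ Ici 0 from self_mem_Ici) (show t ∈ Ici 0 from ht) ht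
  simp only [mul_zero, Real.exp_zero, one_mul] at h
  have h2 := mul_le_mul_of_nonneg_left h (Real.exp_pos (-(2 * lam * t))).le
  rw [← mul_assoc, ← Real.exp_add] at h2
  simpa using h2

/-- the bound for mode with coupling `κ`, when `|θ|/2 ≤ 1 - δ`. -/
lemma ode_bound (lam θ κ δ : ℝ) (hδ : 0 < δ) (hθ : |θ| ≤ 2 * (1 - δ)) (p1 p2 q1 q2 : ℝ → ℝ)
    (c1 : Continuous p1) (c2 : Continuous p2) (c3 : Continuous q1) (c4 : Continuous q2)
    (d1 : ∀ t, 0 < t → HasDerivAt p1 (κ * q2 t) t)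
    (d2 : ∀ t, 0 < t → HasDerivAt p2 (-κ * q1 t) t)
    (d3 : ∀ t, 0 < t → HasDerivAt q1 (κ * p2 t - q1 t) t)
    (d4 : ∀ t, 0 < t → HasDerivAt q2 (-κ * p1 t - q2 t) t)
    (hneg : ∀ t a b c d : ℝ, 0 < t → a = p1 t → b = p2 t → -2 * (c^2+d^2) + θ * (κ * (c^2+d^2) - κ * (a^2+b^2) - (a*d - b*c))
      + 2 * lam * (a^2+b^2+c^2+d^2 + θ * (a*d-b*c)) ≤ 0)
    (t : ℝ) (ht : 0 ≤ t) :
    p1 t^2+p2 t^2+q1 t^2+q2 t^2 ≤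
    (2 / δ) * Real.exp (-(2 * lam * t)) * (p1 0^2+p2 0^2+q1 0^2+q2 0^2) := by
  have h := ode_gen lam θ κ p1 p2 q1 q2 c1 c2 c3 c4 d1 d2 d3 d4 hneg t ht
  have hJ : ∀ a b c d : ℝ, |θ * (a*d-b*c)| ≤ (1 - δ) * (a^2+b^2+c^2+d^2) := by
    intro a b c d
    rw [abs_mul]
    have h1 : |a*d-b*c| ≤ (a^2+b^2+c^2+d^2)/2 := by
      rw [abs_le]; constructor <;> nlinarith [sq_nonneg (a-d), sq_nonneg (b-c), sq_nonneg (a+d), sq_nonneg (b+c)]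
    calc |θ| * |a*d-b*c| ≤ (2 * (1-δ)) * ((a^2+b^2+c^2+d^2)/2) :=
          mul_le_mul hθ h1 (abs_nonneg _) ((abs_nonneg _).trans hθ)
      _ = _ := by ring
  have h1 := (abs_le.1 (hJ (p1 t) (p2 t) (q1 t) (q2 t))).1
  have h2 := (abs_le.1 (hJ (p1 0) (p2 0) (q1 0) (q2 0))).2
  set N0 := p1 0^2+p2 0^2+q1 0^2+q2 0^2 with hN0
  have hN0' : 0 ≤ N0 := by positivity
  have h3 : δ * (p1 t^2+p2 t^2+q1 t^2+q2 t^2) ≤ Real.exp (-(2 * lam * t)) * (2 * N0) := by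
    refine le_trans ?_ (h.trans (mul_le_mul_of_nonneg_left ?_ (Real.exp_pos _).le))
    · linarith
    · nlinarith
  rw [div_mul_eq_mul_div, div_mul_eq_mul_div, le_div_iff₀ hδ]
  linarith

lemma gap (σ : ℝ) (hσ : 0 < σ) (hnotnat : ∀ m : ℕ, 1 / (2 * σ) ≠ (m : ℝ)) :
    ∃ δ > 0, δ ≤ 1 ∧ ∀ n : ℕ, n ≠ 0 → (n * σ < 1/2 ∧ 2 * (n * σ) ≤ 1 - δ) ∨
      (1/2 < n * σ ∧ 1 / (2 * (n * σ)) ≤ 1 - δ) := by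
  set n0 := ⌊1 / (2 * σ)⌋₊ with hn0
  have h1 : (n0 : ℝ) < 1 / (2 * σ) :=
    lt_of_le_of_ne (Nat.floor_le (by positivity)) (hnotnat n0).symm
  have h2 : 1 / (2 * σ) < (n0 : ℝ) + 1 := Nat.lt_floor_add_one _
  rw [lt_div_iff₀ (by positivity)] at h1
  rw [div_lt_iff₀ (by positivity)] at h2
  have h3 : 1 / (2 * σ * (n0 + 1)) < 1 := by
    rw [div_lt_one (by positivity)]; linarith
  refine ⟨min (1 - 2 * σ * n0) (1 - 1 / (2 * σ * (n0 + 1))), lt_min (by linarith) (by linarith),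
    (min_le_right _ _).trans ?_, ?_⟩
  · have : 0 < 1 / (2 * σ * ((n0:ℝ) + 1)) := by positivity
    linarith
  · intro n hn
    rcases le_or_gt n n0 with h | h
    · left
      have h' : (n : ℝ) ≤ n0 := by exact_mod_cast h
      have h5 : (n:ℝ) * σ ≤ n0 * σ := by gcongr
      have := min_le_left (1 - 2 * σ * n0) (1 - 1 / (2 * σ * (n0 + 1)))
      constructor <;> linarith
    · right
      have h' : (n0 : ℝ) + 1 ≤ n := by exact_mod_cast h
      have h5 : ((n0:ℝ)+1) * σ ≤ n * σ := by gcongr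
      have := min_le_right (1 - 2 * σ * n0) (1 - 1 / (2 * σ * (n0 + 1)))
      have h6 : 1 / (2 * (n * σ)) ≤ 1 / (2 * σ * (n0 + 1)) := by
        apply one_div_le_one_div_of_le (by positivity); linarith
      constructor <;> linarith

/-- The small coupling quadratic form. -/
lemma form_small (κ s a b c d : ℝ) (hs : 0 ≤ s) (hk : κ ^ 2 = 1/4 - s^2) :
    -2 * (c^2+d^2) + 4 * κ * (κ * (c^2+d^2) - κ * (a^2+b^2) - (a*d - b*c))
      + 2 * (1/2 - s) * (a^2+b^2+c^2+d^2 + 4 * κ * (a*d-b*c)) ≤ 0 := by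
  have key : 0 ≤ (1+2*s)*(c^2+d^2) + (1-2*s)*(a^2+b^2) + 4*κ*(a*d-b*c) := by
    have h1 : (1+2*s) * ((1+2*s)*(c^2+d^2) + (1-2*s)*(a^2+b^2) + 4*κ*(a*d-b*c))
      = ((1+2*s)*d + 2*κ*a)^2 + ((1+2*s)*c - 2*κ*b)^2 := by
      linear_combination (-4 * (a^2+b^2)) * hk
    have h2 : 0 ≤ (1+2*s) * ((1+2*s)*(c^2+d^2) + (1-2*s)*(a^2+b^2) + 4*κ*(a*d-b*c)) := by
      rw [h1]; positivity
    exact nonneg_of_mul_nonneg_right h2 (by linarith)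
  have h3 : -2 * (c^2+d^2) + 4 * κ * (κ * (c^2+d^2) - κ * (a^2+b^2) - (a*d - b*c))
      + 2 * (1/2 - s) * (a^2+b^2+c^2+d^2 + 4 * κ * (a*d-b*c))
      = - (2 * s * ((1+2*s)*(c^2+d^2) + (1-2*s)*(a^2+b^2) + 4*κ*(a*d-b*c))) := by
    linear_combination (4 * (c^2+d^2) - 4 * (a^2+b^2)) * hk
  rw [h3]
  have := mul_nonneg hs key
  linarith

/-- Uniform modal estimate. -/
lemma mode (σ : ℝ) (hσ : 0 < σ) (lam : ℝ)
    (hlam : lam = if σ < 1/2 then 1/2 - Real.sqrt (1/4 - σ^2) else 1/2)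
    (δ : ℝ) (hδ : 0 < δ) (hδ1 : δ ≤ 1)
    (hgap : ∀ n : ℕ, n ≠ 0 → (n * σ < 1/2 ∧ 2 * (n * σ) ≤ 1 - δ) ∨
      (1/2 < n * σ ∧ 1 / (2 * (n * σ)) ≤ 1 - δ))
    (k : ℤ) (p1 p2 q1 q2 : ℝ → ℝ)
    (c1 : Continuous p1) (c2 : Continuous p2) (c3 : Continuous q1) (c4 : Continuous q2)
    (d1 : ∀ t, 0 < t → HasDerivAt p1 ((k * σ) * q2 t) t)
    (d2 : ∀ t, 0 < t → HasDerivAt p2 (-(k * σ) * q1 t) t)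
    (d3 : ∀ t, 0 < t → HasDerivAt q1 ((k * σ) * p2 t - q1 t) t)
    (d4 : ∀ t, 0 < t → HasDerivAt q2 (-(k * σ) * p1 t - q2 t) t)
    (h0 : k = 0 → p1 0 = 0 ∧ p2 0 = 0)
    (t : ℝ) (ht : 0 ≤ t) :
    p1 t^2+p2 t^2+q1 t^2+q2 t^2 ≤
    (2 / δ) * Real.exp (-(2 * lam * t)) * (p1 0^2+p2 0^2+q1 0^2+q2 0^2) := by
  have hl2 : lam ≤ 1/2 := by
    rw [hlam]; split_ifs
    · linarith [Real.sqrt_nonneg (1/4 - σ^2)]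
    · exact le_rfl
  have hexp : ∀ μ, lam ≤ μ → Real.exp (-(2 * μ * t)) ≤ Real.exp (-(2 * lam * t)) := by
    intro μ hμ
    apply Real.exp_le_exp.2
    nlinarith
  have fin : ∀ μ, lam ≤ μ → p1 t^2+p2 t^2+q1 t^2+q2 t^2 ≤
      (2 / δ) * Real.exp (-(2 * μ * t)) * (p1 0^2+p2 0^2+q1 0^2+q2 0^2) →
      p1 t^2+p2 t^2+q1 t^2+q2 t^2 ≤
      (2 / δ) * Real.exp (-(2 * lam * t)) * (p1 0^2+p2 0^2+q1 0^2+q2 0^2) := by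
    intro μ hμ h
    refine h.trans ?_
    have := hexp μ hμ
    gcongr
  by_cases hk : k = 0
  · subst hk
    obtain ⟨z1, z2⟩ := h0 rfl
    simp only [Int.cast_zero, zero_mul, neg_zero] at d1 d2 d3 d4
    -- p stays zero
    have hz : ∀ p : ℝ → ℝ, Continuous p → (∀ t, 0 < t → HasDerivAt p 0 t) → p 0 = 0 →
        ∀ t, 0 ≤ t → p t = 0 := by
      intro p hc hd hp0 t ht
      by_contra hne
      have hpos : 0 < t := lt_of_le_of_ne ht (fun h => hne (h ▸ hp0))
      obtain ⟨x, hx, hx2⟩ := exists_hasDerivAt_eq_slope p (fun _ => 0) hpos hc.continuousOn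
        (fun x hx => hd x hx.1)
      rw [hp0, eq_comm, div_eq_zero_iff] at hx2
      rcases hx2 with h | h
      · exact hne (by linarith)
      · linarith
    have hp1 := hz p1 c1 d1 z1
    have hp2 := hz p2 c2 d2 z2
    refine fin (1/2) hl2 ?_
    refine ode_bound (1/2) 0 0 δ hδ (by simp; linarith) p1 p2 q1 q2 c1 c2 c3 c4
      (fun t ht => by simpa using d1 t ht) (fun t ht => by simpa using d2 t ht)
      (fun t ht => by simpa using d3 t ht) (fun t ht => by simpa using d4 t ht) ?_ t ht
    intro s a b c d hs ha hb
    rw [ha, hb, hp1 s hs.le, hp2 s hs.le]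
    nlinarith [sq_nonneg c, sq_nonneg d]
  · have hn : k.natAbs ≠ 0 := by simpa using hk
    have hab : (k.natAbs : ℝ) = |(k:ℝ)| := by
      rw [Nat.cast_natAbs]; simp
    have hkap : |(k:ℝ) * σ| = k.natAbs * σ := by rw [abs_mul, abs_of_pos hσ, hab]
    have hsq : ((k:ℝ) * σ)^2 = (k.natAbs * σ)^2 := by rw [← hkap, sq_abs]
    rcases hgap _ hn with ⟨h1, h2⟩ | ⟨h1, h2⟩
    · have hn1 : (1:ℝ) ≤ k.natAbs := by exact_mod_cast Nat.one_le_iff_ne_zero.2 hn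
      have hle : σ ≤ k.natAbs * σ := by nlinarith
      have hs : σ < 1/2 := by linarith
      have hpos : 0 < (k.natAbs : ℝ) * σ := by positivity
      set s := Real.sqrt (1/4 - ((k:ℝ)*σ)^2) with hsdef
      have hs2 : s^2 = 1/4 - ((k:ℝ)*σ)^2 := Real.sq_sqrt (by rw [hsq]; nlinarith)
      have hs0 : 0 ≤ s := Real.sqrt_nonneg _
      refine fin (1/2 - s) ?_ (ode_bound (1/2 - s) (4 * (k * σ)) (k * σ) δ hδ ?_
        p1 p2 q1 q2 c1 c2 c3 c4 d1 d2 d3 d4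
        (fun _ a b c d _ _ _ => form_small (k * σ) s a b c d hs0 (by linarith)) t ht)
      · rw [hlam, if_pos hs]
        have : s ≤ Real.sqrt (1/4 - σ^2) := by
          apply Real.sqrt_le_sqrt; rw [hsq]; nlinarith
        linarith
      · rw [abs_mul, hkap, abs_of_pos (by norm_num : (0:ℝ) < 4)]; linarith
    · have hne : (k:ℝ) * σ ≠ 0 := by positivity
      refine fin (1/2) hl2 (ode_bound (1/2) (1 / (k * σ)) (k * σ) δ hδ ?_
        p1 p2 q1 q2 c1 c2 c3 c4 d1 d2 d3 d4 ?_ t ht)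
      · rw [abs_div, hkap, abs_one]
        have : 1 / (2 * ((k.natAbs:ℝ) * σ)) = (1 / (k.natAbs * σ)) / 2 := by field_simp
        linarith
      · intro _ a b c d _ _ _
        apply le_of_eq
        field_simp
        ring

lemma fc_add (k : ℤ) (f g : ℝ → ℝ) (hf : Continuous f) (hg : Continuous g) :
    fc k (fun x => f x + g x) = fc k f + fc k g := by
  unfold fc
  rw [← intervalIntegral.integral_add]
  · refine intervalIntegral.integral_congr fun x _ => ?_
    simp only
    push_cast; ring
  · exact Continuous.intervalIntegrable (by fun_prop) _ _
  · exact Continuous.intervalIntegrable (by fun_prop) _ _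

lemma fc_smul (k : ℤ) (f : ℝ → ℝ) (r : ℝ) :
    fc k (fun x => r * f x) = r * fc k f := by
  unfold fc
  rw [← intervalIntegral.integral_const_mul]
  refine intervalIntegral.integral_congr fun x _ => ?_
  simp only
  push_cast; ring

lemma hasDerivAt_re_im {f : ℝ → ℂ} {f' : ℂ} {t : ℝ} (h : HasDerivAt f f' t) :
    HasDerivAt (fun s => (f s).re) f'.re t ∧ HasDerivAt (fun s => (f s).im) f'.im t :=
  ⟨Complex.reCLM.hasFDerivAt.comp_hasDerivAt t h, Complex.imCLM.hasFDerivAt.comp_hasDerivAt t h⟩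

/-- modal bound in terms of Fourier coefficients -/
lemma mode_fc (σ : ℝ) (hσ : 0 < σ) (lam : ℝ)
    (hlam : lam = if σ < 1/2 then 1/2 - Real.sqrt (1/4 - σ^2) else 1/2)
    (δ : ℝ) (hδ : 0 < δ) (hδ1 : δ ≤ 1)
    (hgap : ∀ n : ℕ, n ≠ 0 → (n * σ < 1/2 ∧ 2 * (n * σ) ≤ 1 - δ) ∨
      (1/2 < n * σ ∧ 1 / (2 * (n * σ)) ≤ 1 - δ))
    (k : ℤ) (a b : ℝ → ℂ) (ca : Continuous a) (cb : Continuous b)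
    (da : ∀ t, 0 < t → HasDerivAt a (-(k * σ * Complex.I) * a t + (1/2) * (b t - a t)) t)
    (db : ∀ t, 0 < t → HasDerivAt b ((k * σ * Complex.I) * b t - (1/2) * (b t - a t)) t)
    (h0 : k = 0 → a 0 + b 0 = 0) (t : ℝ) (ht : 0 ≤ t) :
    ‖a t‖^2 + ‖b t‖^2 ≤ (2 / δ) * Real.exp (-(2 * lam * t)) * (‖a 0‖^2 + ‖b 0‖^2) := by
  have hh : ((1:ℂ)/2).re = 1/2 ∧ ((1:ℂ)/2).im = 0 := by
    constructor <;> norm_num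
  have dp : ∀ t, 0 < t → HasDerivAt (fun t => a t + b t)
      (-(((k * σ : ℝ) : ℂ) * Complex.I) * (a t - b t)) t := fun t ht =>
    ((da t ht).add (db t ht)).congr_deriv (by push_cast; ring)
  have dq : ∀ t, 0 < t → HasDerivAt (fun t => a t - b t)
      (-(((k * σ : ℝ) : ℂ) * Complex.I) * (a t + b t) - (a t - b t)) t := fun t ht =>
    ((da t ht).sub (db t ht)).congr_deriv (by push_cast; ring)
  have := mode σ hσ lam hlam δ hδ hδ1 hgap k
    (fun t => (a t + b t).re) (fun t => (a t + b t).im)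
    (fun t => (a t - b t).re) (fun t => (a t - b t).im)
    (by fun_prop) (by fun_prop) (by fun_prop) (by fun_prop)
    (fun t ht => (hasDerivAt_re_im (dp t ht)).1.congr_deriv (by
      rw [Complex.mul_re]; simp [-Complex.ofReal_mul]))
    (fun t ht => (hasDerivAt_re_im (dp t ht)).2.congr_deriv (by
      rw [Complex.mul_im]; simp [-Complex.ofReal_mul]))
    (fun t ht => (hasDerivAt_re_im (dq t ht)).1.congr_deriv (by
      rw [Complex.sub_re, Complex.mul_re]; simp [-Complex.ofReal_mul]))
    (fun t ht => (hasDerivAt_re_im (dq t ht)).2.congr_deriv (by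
      rw [Complex.sub_im, Complex.mul_im]; simp [-Complex.ofReal_mul]))
    (fun hk => by simp only [h0 hk]; simp) t ht
  have hN : ∀ s, (a s + b s).re ^ 2 + (a s + b s).im ^ 2 + (a s - b s).re ^ 2
      + (a s - b s).im ^ 2 = 2 * (‖a s‖^2 + ‖b s‖^2) := by
    intro s
    rw [Complex.sq_norm, Complex.sq_norm, Complex.normSq_apply, Complex.normSq_apply]
    simp only [Complex.add_re, Complex.add_im, Complex.sub_re, Complex.sub_im]
    ring
  simp only [hN] at this
  linarith


/-- sharp exponential decay for the two-velocity BGK system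
`∂_t f_± ± σ ∂_x f_± = ±(1/2)(f_- - f_+)` with `2π`-periodic data, under the
non-defectiveness condition `1/(2σ) ∉ ℕ`.  The steady state is
`f_±^∞ = (1/(4π)) ∫₀^{2π} (f_+^I + f_-^I)`, and the rate is
`λ = Re(1/2 - √(1/4 - σ²))`. -/
theorem stmt_13
    (σ : ℝ) (hσ : 0 < σ)
    (hnotnat : ∀ m : ℕ, 1 / (2 * σ) ≠ (m : ℝ))
    (lam : ℝ)
    (hlam : lam = if σ < 1/2 then 1/2 - Real.sqrt (1/4 - σ^2) else 1/2) :
    ∃ c : ℝ, 0 < c ∧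
      ∀ fp fm gp gm : ℝ → ℝ → ℝ, ∀ fpI fmI : ℝ → ℝ, ∀ finf : ℝ,
      -- classical solution, 2π-periodic in x
      Continuous (fun q : ℝ × ℝ => fp q.1 q.2) →
      Continuous (fun q : ℝ × ℝ => fm q.1 q.2) →
      (∀ x t : ℝ, fp (x + 2 * Real.pi) t = fp x t) →
      (∀ x t : ℝ, fm (x + 2 * Real.pi) t = fm x t) →
      (∀ x t : ℝ, 0 ≤ t → HasDerivAt (fun y => fp y t) (gp x t) x) →
      (∀ x t : ℝ, 0 ≤ t → HasDerivAt (fun y => fm y t) (gm x t) x) →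
      (∀ x t : ℝ, 0 ≤ t → HasDerivAt (fun s => fp x s)
          (-σ * gp x t + (1/2) * (fm x t - fp x t)) t) →
      (∀ x t : ℝ, 0 ≤ t → HasDerivAt (fun s => fm x s)
          (σ * gm x t - (1/2) * (fm x t - fp x t)) t) →
      -- initial data
      (∀ x : ℝ, fp x 0 = fpI x) →
      (∀ x : ℝ, fm x 0 = fmI x) →
      -- constant steady state value
      finf = (1 / (4 * Real.pi)) * ∫ x in Set.Ioc (0:ℝ) (2 * Real.pi), (fpI x + fmI x) →
      ∀ t : ℝ, 0 ≤ t →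
        Real.sqrt (∫ x in Set.Ioc (0:ℝ) (2 * Real.pi),
            ((fp x t - finf) ^ 2 + (fm x t - finf) ^ 2)) ≤
          c * Real.exp (-lam * t) *
            Real.sqrt (∫ x in Set.Ioc (0:ℝ) (2 * Real.pi),
              ((fpI x - finf) ^ 2 + (fmI x - finf) ^ 2)) := by

  obtain ⟨δ, hδ, hδ1, hgap⟩ := gap σ hσ hnotnat
  refine ⟨Real.sqrt (2 / δ), by positivity, ?_⟩
  intro fp fm gp gm fpI fmI finf hcp hcm hpp hpm hxp hxm htp htm hIp hIm hinf t ht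
  set u : ℝ → ℝ → ℝ := fun x t => fp x t - finf with hu
  set v : ℝ → ℝ → ℝ := fun x t => fm x t - finf with hv
  set h : ℝ → ℝ → ℝ := fun x t => (1/2) * (fm x t - fp x t) with hh
  have cu : Continuous (fun q : ℝ × ℝ => u q.1 q.2) := hcp.sub continuous_const
  have cv : Continuous (fun q : ℝ × ℝ => v q.1 q.2) := hcm.sub continuous_const
  have ch : Continuous (fun q : ℝ × ℝ => h q.1 q.2) := (hcm.sub hcp).const_mul _
  have pu : ∀ x t, u (x + 2 * π) t = u x t := fun x t => by simp only [hu, hpp]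
  have pv : ∀ x t, v (x + 2 * π) t = v x t := fun x t => by simp only [hv, hpm]
  have ph : ∀ x t, h (x + 2 * π) t = h x t := fun x t => by simp only [hh, hpm, hpp]
  have cux : ∀ t, Continuous (fun x => u x t) := fun t =>
    cu.comp (f := fun x : ℝ => (x, t)) (by fun_prop)
  have cvx : ∀ t, Continuous (fun x => v x t) := fun t =>
    cv.comp (f := fun x : ℝ => (x, t)) (by fun_prop)
  have mu := mild_eq σ u h gp cu ch (fun x t h0 => (hxp x t h0).sub_const _)
    (fun x t h0 => (htp x t h0).sub_const _)
  have mv := mild_eq (-σ) v (fun x t => - h x t) gm cv ch.neg (fun x t h0 => (hxm x t h0).sub_const _)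
    (fun x t h0 => ((htm x t h0).sub_const _).congr_deriv (by simp only [hh]; ring))
  have hfch : ∀ k t, fc k (fun x => h x t) =
      (1/2) * (fc k (fun x => v x t) - fc k (fun x => u x t)) := by
    intro k t
    have e : (fun x => h x t) = fun x => (1/2) * v x t + (-1/2) * u x t := by
      funext x; simp only [hh, hu, hv]; ring
    rw [e, fc_add k _ _ ((cvx t).const_mul _) ((cux t).const_mul _),
      fc_smul k (fun x => v x t), fc_smul k (fun x => u x t)]
    push_cast; ring
  have hfchn : ∀ k t, fc k (fun x => - h x t) = - fc k (fun x => h x t) := by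
    intro k t
    have := fc_smul k (fun x => h x t) (-1)
    simpa using this
  have hmass : fc 0 (fun x => u x 0) + fc 0 (fun x => v x 0) = 0 := by
    rw [← fc_add 0 _ _ (cux 0) (cvx 0)]
    unfold fc
    have e : ∀ x : ℝ, Complex.exp (-(((0:ℤ):ℂ) * x) * Complex.I) * ((u x 0 + v x 0 : ℝ) : ℂ)
        = ((fpI x + fmI x - 2 * finf : ℝ) : ℂ) := by
      intro x
      simp [hu, hv, hIp, hIm]; ring
    simp_rw [e]
    rw [intervalIntegral.integral_ofReal]
    norm_cast
    have cI : Continuous (fun x => fpI x + fmI x) := by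
      have e2 : (fun x => fpI x + fmI x) = fun x => u x 0 + v x 0 + 2 * finf := by
        funext x; simp only [hu, hv, hIp, hIm]; ring
      rw [e2]
      exact ((cux 0).add (cvx 0)).add continuous_const
    rw [intervalIntegral.integral_sub (cI.intervalIntegrable _ _) (by simp),
      intervalIntegral.integral_of_le (by positivity), intervalIntegral.integral_const, hinf]
    simp only [smul_eq_mul]
    field_simp
    ring
  have hmode : ∀ k : ℤ, ‖fc k (fun x => u x t)‖^2 + ‖fc k (fun x => v x t)‖^2 ≤
      (2 / δ) * Real.exp (-(2 * lam * t)) *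
        (‖fc k (fun x => u x 0)‖^2 + ‖fc k (fun x => v x 0)‖^2) := by
    intro k
    refine mode_fc σ hσ lam hlam δ hδ hδ1 hgap k (fun t => fc k (fun x => u x t))
      (fun t => fc k (fun x => v x t)) (fc_cont k u cu) (fc_cont k v cv) ?_ ?_ ?_ t ht
    · intro t ht
      refine (fc_deriv k σ u h cu ch pu ph mu t ht).congr_deriv ?_
      rw [hfch]
    · intro t ht
      refine (fc_deriv k (-σ) v (fun x t => - h x t) cv ch.neg pv
        (fun x t => by simp only [ph]) mv t ht).congr_deriv ?_
      rw [hfchn, hfch]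
      push_cast; ring
    · rintro rfl
      exact hmass
  have hsplit : ∀ t, ∫ x in Set.Ioc (0:ℝ) (2 * π), (u x t ^ 2 + v x t ^ 2) =
      (∫ x in Set.Ioc (0:ℝ) (2 * π), u x t ^ 2) + ∫ x in Set.Ioc (0:ℝ) (2 * π), v x t ^ 2 := by
    intro t
    exact integral_add (((cux t).pow 2).integrableOn_Ioc) (((cvx t).pow 2).integrableOn_Ioc)
  have hS : ∀ t, HasSum (fun k => ‖fc k (fun x => u x t)‖^2 + ‖fc k (fun x => v x t)‖^2)
      (2 * π * ∫ x in Set.Ioc (0:ℝ) (2 * π), (u x t ^ 2 + v x t ^ 2)) := by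
    intro t
    rw [hsplit, mul_add]
    exact (fc_parseval _ (cux t)).add (fc_parseval _ (cvx t))
  have hfin := hasSum_le hmode (hS t) ((hS 0).mul_left _)
  have hfin2 : ∫ x in Set.Ioc (0:ℝ) (2 * π), (u x t ^ 2 + v x t ^ 2) ≤
      (2 / δ) * Real.exp (-(2 * lam * t)) *
        ∫ x in Set.Ioc (0:ℝ) (2 * π), (u x 0 ^ 2 + v x 0 ^ 2) := by
    have hpi : (0:ℝ) < 2 * π := by positivity
    refine le_of_mul_le_mul_left ?_ hpi
    linarith
  simp_rw [← hIp, ← hIm]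
  have hexp : Real.exp (-lam * t) = Real.sqrt (Real.exp (-(2 * lam * t))) := by
    rw [eq_comm, Real.sqrt_eq_iff_mul_self_eq (Real.exp_pos _).le (Real.exp_pos _).le,
      ← Real.exp_add]
    congr 1; ring
  rw [hexp, ← Real.sqrt_mul (by positivity), ← Real.sqrt_mul (by positivity)]
  exact Real.sqrt_le_sqrt hfin2
end
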